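/- arXiv:2006.00893 — 2 statements merged into one kernel-verified Lean document; each statement's English description precedes it below -/
import Mathlib

section
/- Let κ be an infinite cardinal and 𝓑 an unbounded bornology on κ such that every initial segment [0,α] = {γ < κ : γ ≤ α} (α < κ) belongs to 𝓑. In the 𝓑-macrocube, the sets Y = { {α} : α < κ } and Z = { [0,α] : α < κ } are asymptotically disjoint. -/
open scoped symmDiff

/-- A bornology on a set (type) `ι`: a family of subsets containing all finite
subsets, closed under taking subsets and finite unions. -/
def IsBornology {ι : Type*} (𝓑 : Set (Set ι)) : Prop :=
  (∀ A : Set ι, A.Finite → A ∈ 𝓑) ∧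
  (∀ A B : Set ι, A ∈ 𝓑 → B ⊆ A → B ∈ 𝓑) ∧
  (∀ A B : Set ι, A ∈ 𝓑 → B ∈ 𝓑 → A ∪ B ∈ 𝓑)

/-- `E_B[Y]` in the `𝓑`-macrocube: the points of the macrocube (members of `𝓑`)
that are `B`-close to some member of `Y`. -/
def mcE {ι : Type*} (𝓑 : Set (Set ι)) (B : Set ι) (Y : Set (Set ι)) : Set (Set ι) :=
  {A | A ∈ 𝓑 ∧ ∃ A' ∈ Y, A ∆ A' ⊆ B}

/-- A subset of the `𝓑`-macrocube is bounded if all pairwise symmetric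
differences are contained in a single member of `𝓑`. -/
def mcBounded {ι : Type*} (𝓑 : Set (Set ι)) (Y : Set (Set ι)) : Prop :=
  ∃ B ∈ 𝓑, ∀ A ∈ Y, ∀ A' ∈ Y, A ∆ A' ⊆ B

/-- Asymptotic disjointness in the `𝓑`-macrocube. -/
def mcAsympDisjoint {ι : Type*} (𝓑 : Set (Set ι)) (Y Z : Set (Set ι)) : Prop :=
  ∀ B ∈ 𝓑, mcBounded 𝓑 (mcE 𝓑 B Y ∩ mcE 𝓑 B Z)

/-- `U` is an asymptotic neighbourhood of `Y` in the `𝓑`-macrocube. -/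
def mcAsympNbhd {ι : Type*} (𝓑 : Set (Set ι)) (Y U : Set (Set ι)) : Prop :=
  ∀ B ∈ 𝓑, mcBounded 𝓑 (mcE 𝓑 B Y \ U)

/-- The `𝓑`-macrocube is normal: any two asymptotically disjoint subsets have
disjoint asymptotic neighbourhoods. -/
def mcNormal {ι : Type*} (𝓑 : Set (Set ι)) : Prop :=
  ∀ Y Z : Set (Set ι), Y ⊆ 𝓑 → Z ⊆ 𝓑 → mcAsympDisjoint 𝓑 Y Z →
    ∃ U V : Set (Set ι), mcAsympNbhd 𝓑 Y U ∧ mcAsympNbhd 𝓑 Z V ∧ Disjoint U V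

/-- `𝓑` has a linearly ordered base. -/
def HasLinearBase {ι : Type*} (𝓑 : Set (Set ι)) : Prop :=
  ∃ 𝓒 ⊆ 𝓑, IsChain (· ⊆ ·) 𝓒 ∧ ∀ B ∈ 𝓑, ∃ C ∈ 𝓒, B ⊆ C

/-- The complement of a member of an unbounded bornology is infinite. -/
theorem IsBornology.infinite_compl {ι : Type*} {𝓑 : Set (Set ι)} (hB : IsBornology 𝓑)
    (hunb : Set.univ ∉ 𝓑) {B : Set ι} (hmem : B ∈ 𝓑) : Bᶜ.Infinite := fun hfin =>
  hunb (Set.union_compl_self B ▸ hB.2.2 _ _ hmem (hB.1 _ hfin))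

/-- A family of sets with a common upper bound in `𝓑` is bounded in the `𝓑`-macrocube. -/
theorem mcBounded_of_forall_subset {ι : Type*} {𝓑 Y : Set (Set ι)} {C : Set ι} (hC : C ∈ 𝓑)
    (h : ∀ A ∈ Y, A ⊆ C) : mcBounded 𝓑 Y :=
  ⟨C, hC, fun A hA A' hA' => symmDiff_le_sup.trans (sup_le (h A hA) (h A' hA'))⟩

/-- In the `𝓑`-macrocube over a well-ordered infinite set `κ` whose initial
segments all belong to `𝓑`, the set of singletons `Y = {{α} : α < κ}` and the
set of initial segments `Z = {[0,α] : α < κ}` are asymptotically disjoint. -/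
theorem macrocube_singletons_asympDisjoint_initialSegments
    {κ : Type*} [LinearOrder κ] [WellFoundedLT κ] [Infinite κ]
    (𝓑 : Set (Set κ)) (hB : IsBornology 𝓑) (hunb : Set.univ ∉ 𝓑)
    (hIic : ∀ α : κ, Set.Iic α ∈ 𝓑) :
    mcAsympDisjoint 𝓑 {S | ∃ α : κ, S = {α}} {S | ∃ α : κ, S = Set.Iic α} := by
  intro B hmem
  obtain ⟨γ, hγ, δ, hδ, hlt⟩ := (hB.infinite_compl hunb hmem).nontrivial.exists_lt
  refine mcBounded_of_forall_subset (hB.2.2 _ _ hmem (hIic δ)) ?_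
  rintro A ⟨⟨-, _, ⟨α, rfl⟩, hα⟩, -, _, ⟨β, rfl⟩, hβ⟩
  have hclose : ({α} : Set κ) ∆ Set.Iic β ⊆ B :=
    (symmDiff_triangle {α} A (Set.Iic β)).trans (sup_le (symmDiff_comm A {α} ▸ hα) hβ)
  have eq_of_notMem : ∀ x ∉ B, x ≤ β → x = α := fun x hx hxβ => by
    by_contra hne
    exact hx (hclose (Or.inr ⟨hxβ, hne⟩))
  have hβδ : β ≤ δ := by
    by_contra! hδβ
    exact hlt.ne ((eq_of_notMem γ hγ (hlt.trans hδβ).le).trans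
      (eq_of_notMem δ hδ hδβ.le).symm)
  intro x hx
  by_cases hxβ : x ≤ β
  · exact Or.inr (hxβ.trans hβδ)
  · exact Or.inl (hβ (Or.inl ⟨hx, hxβ⟩))
end

section
/- Every connected ballean (X, 𝓔) whose coarse structure 𝓔 has a base that is linearly ordered by inclusion is normal. -/
/-- `𝓔` is a coarse structure on `X`: each entourage contains the diagonal,
and `𝓔` is closed under composition, inversion and taking sub-entourages
containing the diagonal. -/
def IsCoarseStructure {X : Type*} (𝓔 : Set (Set (X × X))) : Prop :=
  (∀ E ∈ 𝓔, ∀ x : X, (x, x) ∈ E) ∧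
  (∀ E ∈ 𝓔, ∀ F ∈ 𝓔, {p : X × X | ∃ z : X, (p.1, z) ∈ E ∧ (z, p.2) ∈ F} ∈ 𝓔) ∧
  (∀ E ∈ 𝓔, {p : X × X | (p.2, p.1) ∈ E} ∈ 𝓔) ∧
  (∀ E ∈ 𝓔, ∀ E' : Set (X × X), (∀ x : X, (x, x) ∈ E') → E' ⊆ E → E' ∈ 𝓔)

/-- The ballean `(X, 𝓔)` is connected. -/
def CoarseConnected {X : Type*} (𝓔 : Set (Set (X × X))) : Prop :=
  ∀ x y : X, ∃ E ∈ 𝓔, (x, y) ∈ E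

/-- The ball `E[x]` of radius `E` centered at `x`. -/
def cBall {X : Type*} (E : Set (X × X)) (x : X) : Set X := {y | (x, y) ∈ E}

/-- `E[Y] = ⋃_{y ∈ Y} E[y]`. -/
def cBallSet {X : Type*} (E : Set (X × X)) (Y : Set X) : Set X :=
  {z | ∃ y ∈ Y, (y, z) ∈ E}

/-- A subset of `X` is bounded if it is contained in some ball. -/
def cBounded {X : Type*} (𝓔 : Set (Set (X × X))) (Y : Set X) : Prop :=
  ∃ E ∈ 𝓔, ∃ x : X, Y ⊆ cBall E x

/-- `Y` and `Z` are asymptotically disjoint. -/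
def cAsympDisjoint {X : Type*} (𝓔 : Set (Set (X × X))) (Y Z : Set X) : Prop :=
  ∀ E ∈ 𝓔, cBounded 𝓔 (cBallSet E Y ∩ cBallSet E Z)

/-- `U` is an asymptotic neighbourhood of `Y`. -/
def cAsympNbhd {X : Type*} (𝓔 : Set (Set (X × X))) (Y U : Set X) : Prop :=
  ∀ E ∈ 𝓔, cBounded 𝓔 (cBallSet E Y \ U)

/-- The ballean `(X, 𝓔)` is normal. -/
def cNormal {X : Type*} (𝓔 : Set (Set (X × X))) : Prop :=
  ∀ Y Z : Set X, cAsympDisjoint 𝓔 Y Z →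
    ∃ U V : Set X, cAsympNbhd 𝓔 Y U ∧ cAsympNbhd 𝓔 Z V ∧ Disjoint U V

theorem cBallSet_mono_left {X : Type*} {E F : Set (X × X)} (h : E ⊆ F) (Y : Set X) :
    cBallSet E Y ⊆ cBallSet F Y :=
  fun _ ⟨y, hy, hyz⟩ => ⟨y, hy, h hyz⟩

theorem cBounded.subset {X : Type*} {𝓔 : Set (Set (X × X))} {Y Z : Set X}
    (hZ : cBounded 𝓔 Z) (h : Y ⊆ Z) : cBounded 𝓔 Y := by
  obtain ⟨E, hE, x, hx⟩ := hZ
  exact ⟨E, hE, x, h.trans hx⟩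

/-- The points that some entourage of `𝓑` reaches from `Y` but not from `Z`. -/
def separatingSet {X : Type*} (𝓑 : Set (Set (X × X))) (Y Z : Set X) : Set X :=
  {x | ∃ E ∈ 𝓑, x ∈ cBallSet E Y \ cBallSet E Z}

theorem cAsympNbhd_separatingSet {X : Type*} {𝓔 𝓑 : Set (Set (X × X))} {Y Z : Set X}
    (hsub : 𝓑 ⊆ 𝓔) (hcof : ∀ E ∈ 𝓔, ∃ F ∈ 𝓑, E ⊆ F) (h : cAsympDisjoint 𝓔 Y Z) :
    cAsympNbhd 𝓔 Y (separatingSet 𝓑 Y Z) := by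
  intro E hE
  obtain ⟨F, hF, hEF⟩ := hcof E hE
  refine (h F (hsub hF)).subset fun x ⟨hxY, hx⟩ => ?_
  have hxF := cBallSet_mono_left hEF Y hxY
  exact ⟨hxF, by_contra fun hxZ => hx ⟨F, hF, hxF, hxZ⟩⟩

theorem disjoint_separatingSet {X : Type*} {𝓑 : Set (Set (X × X))}
    (hchain : IsChain (· ⊆ ·) 𝓑) (Y Z : Set X) :
    Disjoint (separatingSet 𝓑 Y Z) (separatingSet 𝓑 Z Y) := by
  rw [Set.disjoint_left]
  rintro x ⟨E, hE, hEY, hEZ⟩ ⟨F, hF, hFZ, hFY⟩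
  rcases hchain.total hE hF with hEF | hFE
  · exact hFY (cBallSet_mono_left hEF Y hEY)
  · exact hEZ (cBallSet_mono_left hFE Z hFZ)

theorem cAsympDisjoint.symm {X : Type*} {𝓔 : Set (Set (X × X))} {Y Z : Set X}
    (h : cAsympDisjoint 𝓔 Y Z) : cAsympDisjoint 𝓔 Z Y :=
  fun E hE => (h E hE).subset (Set.inter_comm _ _).subset

/-- **Proposition 1.1 of [6].** Every connected ballean whose coarse structure
has a base linearly ordered by inclusion is normal. -/
theorem ballean_normal_of_linearly_ordered_base {X : Type*}
    (𝓔 : Set (Set (X × X))) (hE : IsCoarseStructure 𝓔) (hconn : CoarseConnected 𝓔)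
    (hbase : ∃ 𝓔' ⊆ 𝓔, IsChain (· ⊆ ·) 𝓔' ∧ ∀ E ∈ 𝓔, ∃ E' ∈ 𝓔', E ⊆ E') :
    cNormal 𝓔 := by
  obtain ⟨𝓑, hsub, hchain, hcof⟩ := hbase
  intro Y Z hYZ
  exact ⟨separatingSet 𝓑 Y Z, separatingSet 𝓑 Z Y, cAsympNbhd_separatingSet hsub hcof hYZ,
    cAsympNbhd_separatingSet hsub hcof hYZ.symm, disjoint_separatingSet hchain Y Z⟩
end
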